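/- Let r > 0 and let x ∈ [0,1]^d satisfy ‖x‖₁ = Σ_{i=1}^d x_i < 1, and let η ∼ NegMultinomial(r, x). Then for all distinct j₁, j₂ ∈ {1,…,d}, E[η_{j₁}³ η_{j₂}] = y_{j₁} y_{j₂}[(r+1)^{(2)} + 3(r+2)^{(3)} y_{j₁} + (r+3)^{(4)} y_{j₁}²], where m^{(k)} denotes the k-th order falling factorial of m. -/

import Mathlib

open scoped BigOperators

/-- The `k`-th order falling factorial `m^{(k)} = m(m-1)⋯(m-k+1)` of a real number `m`. -/
noncomputable def fallingFactorial (m : ℝ) (k : ℕ) : ℝ :=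
  ∏ i ∈ Finset.range k, (m - (i : ℝ))

/-- The probability mass function of the negative multinomial distribution
`NegMultinomial(r, x)` on `ℕ₀^d`. -/
noncomputable def negMultinomialPMF (d : ℕ) (r : ℝ) (x : Fin d → ℝ) (k : Fin d → ℕ) : ℝ :=
  Real.Gamma (r + ∑ i, (k i : ℝ)) / (Real.Gamma r * ∏ i, Real.Gamma ((k i : ℝ) + 1)) *
    (1 - ∑ i, x i) ^ r * ∏ i, (x i) ^ (k i)

theorem Finset.hasSum_subtype_of_mem_iff {α : Type*} {p : α → Prop} {S : Finset α}
    (hS : ∀ k, k ∈ S ↔ p k) (f : α → ℝ) :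
    HasSum (fun k : {k // p k} => f k) (∑ k ∈ S, f k) := by
  obtain rfl : (fun k => k ∈ S) = p := funext fun k => propext (hS k)
  exact S.hasSum f

theorem Real.Gamma_add_natCast_eq_ascPochhammer_smeval {s : ℝ} (hs : 0 < s) (n : ℕ) :
    Real.Gamma (s + n) = Real.Gamma s * (ascPochhammer ℕ n).smeval s := by
  induction n with
  | zero => simp
  | succ n ih =>
    rw [Nat.cast_succ, ← add_assoc, Real.Gamma_add_one (by positivity), ih, ascPochhammer_succ_right,
      Polynomial.smeval_mul, Polynomial.smeval_add, Polynomial.smeval_X, Polynomial.smeval_natCast]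
    simp
    ring

/-- The negative binomial series, with coefficients expressed through the Gamma function. -/
theorem Real.hasSum_Gamma_mul_pow {s : ℝ} (hs : 0 < s) {p : ℝ} (hp0 : 0 ≤ p) (hp1 : p < 1) :
    HasSum (fun n : ℕ => Real.Gamma (s + n) / (Real.Gamma s * n.factorial) * p ^ n)
      (1 / (1 - p) ^ s) := by
  have h := (Real.one_div_one_sub_rpow_hasFPowerSeriesOnBall_zero s).hasSum (y := p) (by
    rw [mem_eball_zero_iff, Real.enorm_eq_ofReal hp0]
    exact ENNReal.ofReal_lt_one.mpr hp1)
  simp only [zero_add, FormalMultilinearSeries.ofScalars_apply_eq, smul_eq_mul] at h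
  refine h.congr_fun fun n => ?_
  have hn : (n.factorial : ℝ) ≠ 0 := by positivity
  have hG : Real.Gamma s ≠ 0 := (Real.Gamma_pos_of_pos hs).ne'
  have key := Ring.factorial_nsmul_multichoose_eq_ascPochhammer s n
  rw [Ring.multichoose_eq, nsmul_eq_mul] at key
  rw [Real.Gamma_add_natCast_eq_ascPochhammer_smeval hs, ← key]
  field_simp

section

variable {d : ℕ} {s : ℝ} {x : Fin d → ℝ}

theorem negMultinomialPMF_nonneg (hs : 0 < s) (hx : ∀ i, 0 ≤ x i) (hx1 : ∑ i, x i < 1)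
    (k : Fin d → ℕ) : 0 ≤ negMultinomialPMF d s x k := by
  unfold negMultinomialPMF
  have h1 : 0 ≤ Real.Gamma (s + ∑ i, (k i : ℝ)) := (Real.Gamma_pos_of_pos (by positivity)).le
  have h2 : 0 ≤ Real.Gamma s := (Real.Gamma_pos_of_pos hs).le
  have h3 : 0 ≤ ∏ i, Real.Gamma ((k i : ℝ) + 1) :=
    Finset.prod_nonneg fun i _ => (Real.Gamma_pos_of_pos (by positivity)).le
  have h4 : 0 ≤ (1 - ∑ i, x i) ^ s := Real.rpow_nonneg (by linarith) _
  have h5 : 0 ≤ ∏ i, x i ^ k i := Finset.prod_nonneg fun i _ => pow_nonneg (hx i) _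
  positivity

/-- The total mass of the negative multinomial distribution on `{k | ‖k‖₁ = n}`. -/
theorem sum_piAntidiag_negMultinomialPMF (n : ℕ) :
    ∑ k ∈ Finset.univ.piAntidiag n, negMultinomialPMF d s x k =
      (1 - ∑ i, x i) ^ s *
        (Real.Gamma (s + n) / (Real.Gamma s * n.factorial) * (∑ i, x i) ^ n) := by
  rw [Finset.sum_pow_eq_sum_piAntidiag, Finset.mul_sum, Finset.mul_sum]
  refine Finset.sum_congr rfl fun k hk => ?_
  have hsum : ∑ i, k i = n := (Finset.mem_piAntidiag.mp hk).1
  have hspec := Nat.multinomial_spec Finset.univ k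
  rw [hsum] at hspec
  have hspec' : (∏ i, ((k i).factorial : ℝ)) * (Nat.multinomial Finset.univ k : ℝ) =
      n.factorial := by exact_mod_cast hspec
  have hk0 : (∏ i, ((k i).factorial : ℝ)) ≠ 0 :=
    Finset.prod_ne_zero_iff.mpr fun i _ => by positivity
  have hn : (n.factorial : ℝ) ≠ 0 := by positivity
  have hm : (Nat.multinomial Finset.univ k : ℝ) ≠ 0 := right_ne_zero_of_mul (hspec' ▸ hn)
  have hcast : ∑ i, (k i : ℝ) = n := by exact_mod_cast hsum
  simp only [negMultinomialPMF, Real.Gamma_nat_eq_factorial, hcast]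
  rw [← hspec']
  field_simp

theorem hasSum_negMultinomialPMF (hs : 0 < s) (hx : ∀ i, 0 ≤ x i) (hx1 : ∑ i, x i < 1) :
    HasSum (negMultinomialPMF d s x) 1 := by
  have hfib : ∀ n : ℕ, HasSum
      (fun k : {k : Fin d → ℕ // ∑ i, k i = n} => negMultinomialPMF d s x k)
      ((1 - ∑ i, x i) ^ s *
        (Real.Gamma (s + n) / (Real.Gamma s * n.factorial) * (∑ i, x i) ^ n)) := by
    intro n
    rw [← sum_piAntidiag_negMultinomialPMF]
    exact Finset.hasSum_subtype_of_mem_iff (by simp) _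
  have hpos : 0 < (1 - ∑ i, x i) ^ s := Real.rpow_pos_of_pos (by linarith) _
  have htot := (Real.hasSum_Gamma_mul_pow hs (Finset.sum_nonneg fun i _ => hx i) hx1).mul_left
    ((1 - ∑ i, x i) ^ s)
  rw [mul_one_div_cancel hpos.ne'] at htot
  rw [← (Equiv.sigmaFiberEquiv fun k : Fin d → ℕ => ∑ i, k i).hasSum_iff]
  have hsummable : Summable
      (negMultinomialPMF d s x ∘ Equiv.sigmaFiberEquiv fun k : Fin d → ℕ => ∑ i, k i) := by
    refine (summable_sigma_of_nonneg fun k => negMultinomialPMF_nonneg hs hx hx1 _).mpr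
      ⟨fun n => (hfib n).summable, ?_⟩
    exact htot.summable.congr fun n => (hfib n).tsum_eq.symm
  exact (hsummable.hasSum.sigma hfib).unique htot ▸ hsummable.hasSum

theorem negMultinomialPMF_add_single (hs : 0 < s) (hx1 : ∑ i, x i < 1) (j : Fin d)
    (k : Fin d → ℕ) :
    negMultinomialPMF d s x (k + Pi.single j 1) * ((k j : ℝ) + 1) =
      s * (x j / (1 - ∑ i, x i)) * negMultinomialPMF d (s + 1) x k := by
  have hp : 0 < 1 - ∑ i, x i := by linarith
  have hG : Real.Gamma s ≠ 0 := (Real.Gamma_pos_of_pos hs).ne'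
  have hsum : ∑ i, (((k + Pi.single j 1 : Fin d → ℕ) i : ℕ) : ℝ) = ∑ i, (k i : ℝ) + 1 := by
    simp [Finset.sum_add_distrib, Pi.single_apply]
  have hprod : ∏ i, x i ^ (k + Pi.single j 1 : Fin d → ℕ) i = (∏ i, x i ^ k i) * x j := by
    simp only [Pi.add_apply, pow_add, Finset.prod_mul_distrib]
    simp [Pi.single_apply, pow_ite, Finset.prod_ite_eq']
  have hfac : ∏ i, Real.Gamma (((k + Pi.single j 1 : Fin d → ℕ) i : ℕ) + 1) =
      (∏ i, Real.Gamma ((k i : ℝ) + 1)) * ((k j : ℝ) + 1) := by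
    have : ∀ i, Real.Gamma (((k + Pi.single j 1 : Fin d → ℕ) i : ℕ) + 1) =
        Real.Gamma ((k i : ℝ) + 1) * (if i = j then (k j : ℝ) + 1 else 1) := by
      intro i
      by_cases h : i = j
      · subst h
        simp only [Pi.add_apply, Pi.single_eq_same, Nat.cast_add, Nat.cast_one, if_true]
        rw [Real.Gamma_add_one (by positivity), mul_comm]
      · simp [h]
    rw [Finset.prod_congr rfl fun i _ => this i, Finset.prod_mul_distrib, Finset.prod_ite_eq']
    simp
  have hk : (∏ i, Real.Gamma ((k i : ℝ) + 1)) ≠ 0 :=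
    Finset.prod_ne_zero_iff.mpr fun i _ => (Real.Gamma_pos_of_pos (by positivity)).ne'
  have hkj : (k j : ℝ) + 1 ≠ 0 := by positivity
  rw [negMultinomialPMF, negMultinomialPMF, hsum, hprod, hfac, Real.Gamma_add_one hs.ne',
    Real.rpow_add_one hp.ne', show s + 1 + ∑ i, (k i : ℝ) = s + (∑ i, (k i : ℝ) + 1) by ring]
  field_simp

/-- The size-bias identity `E_s[η_j g(η)] = s y_j E_{s+1}[g(η + e_j)]`. -/
theorem hasSum_negMultinomialPMF_mul_coord (hs : 0 < s) (hx1 : ∑ i, x i < 1) (j : Fin d)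
    {g : (Fin d → ℕ) → ℝ} {a : ℝ}
    (h : HasSum (fun k => negMultinomialPMF d (s + 1) x k * g (k + Pi.single j 1)) a) :
    HasSum (fun k => negMultinomialPMF d s x k * ((k j : ℝ) * g k))
      (s * (x j / (1 - ∑ i, x i)) * a) := by
  have hinj : Function.Injective fun k : Fin d → ℕ => k + Pi.single j 1 :=
    add_left_injective _
  rw [← hinj.hasSum_iff]
  · refine (h.mul_left (s * (x j / (1 - ∑ i, x i)))).congr_fun fun k => ?_
    rw [← mul_assoc, ← negMultinomialPMF_add_single hs hx1]
    simp
    ring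
  · intro k hk
    have : k j = 0 := by
      by_contra h0
      refine hk ⟨k - Pi.single j 1, ?_⟩
      ext i
      by_cases hi : i = j
      · subst hi
        simp
        omega
      · simp [hi]
    simp [this]

end

theorem negMultinomial_moment31 (d : ℕ) (r : ℝ) (hr : 0 < r) (x : Fin d → ℝ)
    (hx : ∀ i, x i ∈ Set.Icc (0 : ℝ) 1) (hx1 : ∑ i, x i < 1)
    (y : Fin d → ℝ) (hy : ∀ i, y i = x i / (1 - ∑ j, x j))
    (j₁ j₂ : Fin d) (h12 : j₁ ≠ j₂) :
    (∑' η : Fin d → ℕ, negMultinomialPMF d r x η * ((η j₁ : ℝ) ^ 3 * (η j₂ : ℝ)))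
      = y j₁ * y j₂ * (fallingFactorial (r + 1) 2 + 3 * fallingFactorial (r + 2) 3 * y j₁ +
          fallingFactorial (r + 3) 4 * (y j₁) ^ 2) := by
  have m0 : ∀ s : ℝ, 0 < s → HasSum (fun k => negMultinomialPMF d s x k) 1 := fun s hs =>
    hasSum_negMultinomialPMF hs (fun i => (hx i).1) hx1
  have step : ∀ (s : ℝ) (_ : 0 < s) (j : Fin d) (g : (Fin d → ℕ) → ℝ) (a : ℝ),
      HasSum (fun k => negMultinomialPMF d (s + 1) x k * g (k + Pi.single j 1)) a →
      HasSum (fun k => negMultinomialPMF d s x k * ((k j : ℝ) * g k)) (s * y j * a) := by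
    intro s hs j g a h
    rw [hy j]
    exact hasSum_negMultinomialPMF_mul_coord hs hx1 j h
  have m1 : ∀ s : ℝ, 0 < s → HasSum (fun k => negMultinomialPMF d s x k * (k j₁ : ℝ))
      (s * y j₁) := by
    intro s hs
    simpa using step s hs j₁ (fun _ => 1) 1 (by simpa using m0 (s + 1) (by positivity))
  have m2 : ∀ s : ℝ, 0 < s → HasSum (fun k => negMultinomialPMF d s x k * (k j₁ : ℝ) ^ 2)
      (s * y j₁ * ((s + 1) * y j₁ + 1)) := by
    intro s hs
    refine (step s hs j₁ (fun k => (k j₁ : ℝ)) _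
      (((m1 (s + 1) (by positivity)).add (m0 (s + 1) (by positivity))).congr_fun
        fun k => ?_)).congr_fun fun k => ?_
    · simp
      ring
    · ring
  have m3 : ∀ s : ℝ, 0 < s → HasSum (fun k => negMultinomialPMF d s x k * (k j₁ : ℝ) ^ 3)
      (s * y j₁ * ((s + 1) * y j₁ * ((s + 1 + 1) * y j₁ + 1) + 2 * ((s + 1) * y j₁) + 1)) := by
    intro s hs
    refine (step s hs j₁ (fun k => (k j₁ : ℝ) ^ 2) _
      ((((m2 (s + 1) (by positivity)).add ((m1 (s + 1) (by positivity)).mul_left 2)).add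
        (m0 (s + 1) (by positivity))).congr_fun fun k => ?_)).congr_fun fun k => ?_
    · simp
      ring
    · ring
  have m31 := step r hr j₂ (fun k => (k j₁ : ℝ) ^ 3) _
    ((m3 (r + 1) (by positivity)).congr_fun fun k => by simp [h12])
  rw [(m31.congr_fun fun k => by ring : HasSum (fun k => negMultinomialPMF d r x k *
    ((k j₁ : ℝ) ^ 3 * (k j₂ : ℝ))) _).tsum_eq]
  simp [fallingFactorial, Finset.prod_range_succ]
  ring
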